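/- Let V be a real vector space of dimension 2n carrying a nondegenerate alternating bilinear form Ω, and let E be a complex subspace of the complexification V_ℂ such that dim_ℂ E = n, the complex-bilinear extension Ω_ℂ vanishes identically on E × E (i.e., E is Lagrangian), and E ∩ Ē = {0}. Then there exists a unique ℝ-linear map K : V → V such that (i) K ∘ K = −id_V and (ii) E = {v + i·Kv : v ∈ V}; moreover this K satisfies (iii) Ω(Kv, Kw) = Ω(v, w) for all v, w ∈ V, and (iv) the bilinear form B(v, w) := Ω(v, Kw) is symmetric and nondegenerate. -/

import Mathlib

open TensorProduct

/-- The complex conjugation on the complexification `ℂ ⊗[ℝ] V` of a real vector space `V`,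
sending `v + i·w` to `v - i·w` (i.e. `z ⊗ v ↦ z̄ ⊗ v`), as an `ℝ`-linear map. -/
noncomputable def complexificationConj (V : Type*) [AddCommGroup V] [Module ℝ V] :
    (ℂ ⊗[ℝ] V) →ₗ[ℝ] (ℂ ⊗[ℝ] V) :=
  LinearMap.rTensor V (Complex.conjAe.toLinearMap : ℂ →ₗ[ℝ] ℂ)

/-- The real part `v + i·w ↦ v` on the complexification of a real vector space. -/
noncomputable def complexificationRe (V : Type*) [AddCommGroup V] [Module ℝ V] :
    (ℂ ⊗[ℝ] V) →ₗ[ℝ] V :=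
  (TensorProduct.lid ℝ V).toLinearMap ∘ₗ LinearMap.rTensor V Complex.reLm

/-- The imaginary part `v + i·w ↦ w` on the complexification of a real vector space. -/
noncomputable def complexificationIm (V : Type*) [AddCommGroup V] [Module ℝ V] :
    (ℂ ⊗[ℝ] V) →ₗ[ℝ] V :=
  (TensorProduct.lid ℝ V).toLinearMap ∘ₗ LinearMap.rTensor V Complex.imLm

section Complexification

variable {V : Type*} [AddCommGroup V] [Module ℝ V]

@[simp]
theorem complexificationConj_tmul (z : ℂ) (v : V) :
    complexificationConj V (z ⊗ₜ[ℝ] v) = (starRingEnd ℂ z) ⊗ₜ[ℝ] v := rfl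

@[simp]
theorem complexificationRe_tmul (z : ℂ) (v : V) :
    complexificationRe V (z ⊗ₜ[ℝ] v) = z.re • v := by
  simp [complexificationRe]

@[simp]
theorem complexificationIm_tmul (z : ℂ) (v : V) :
    complexificationIm V (z ⊗ₜ[ℝ] v) = z.im • v := by
  simp [complexificationIm]

theorem one_tmul_re_add_I_tmul_im (x : ℂ ⊗[ℝ] V) :
    (1 : ℂ) ⊗ₜ[ℝ] complexificationRe V x + Complex.I ⊗ₜ[ℝ] complexificationIm V x = x := by
  induction x with
  | zero => simp
  | tmul z v =>
    rw [complexificationRe_tmul, complexificationIm_tmul, ← TensorProduct.smul_tmul,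
      ← TensorProduct.smul_tmul, ← TensorProduct.add_tmul]
    congr 1
    apply Complex.ext <;> simp
  | add x y hx hy =>
    nth_rewrite 3 [← hx, ← hy]
    simp only [map_add, TensorProduct.tmul_add]
    abel

theorem complexificationRe_I_smul (x : ℂ ⊗[ℝ] V) :
    complexificationRe V (Complex.I • x) = -complexificationIm V x := by
  induction x with
  | zero => simp
  | tmul z v => simp [TensorProduct.smul_tmul']
  | add x y hx hy => simp only [smul_add, map_add, hx, hy, neg_add]

theorem complexificationIm_I_smul (x : ℂ ⊗[ℝ] V) :
    complexificationIm V (Complex.I • x) = complexificationRe V x := by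
  induction x with
  | zero => simp
  | tmul z v => simp [TensorProduct.smul_tmul']
  | add x y hx hy => simp only [smul_add, map_add, hx, hy]

/-- A complex subspace that meets its conjugate trivially contains no nonzero purely imaginary
vector. -/
theorem eq_zero_of_complexificationRe_eq_zero {E : Submodule ℂ (ℂ ⊗[ℝ] V)}
    (hE : (E : Set (ℂ ⊗[ℝ] V)) ∩ (complexificationConj V '' (E : Set (ℂ ⊗[ℝ] V))) = {0})
    {x : ℂ ⊗[ℝ] V} (hx : x ∈ E) (hre : complexificationRe V x = 0) : x = 0 := by
  have h : x ∈ (E : Set (ℂ ⊗[ℝ] V)) ∩ (complexificationConj V '' (E : Set (ℂ ⊗[ℝ] V))) := by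
    refine ⟨hx, -x, E.neg_mem hx, ?_⟩
    rw [← one_tmul_re_add_I_tmul_im x, hre]
    simp [TensorProduct.neg_tmul]
  rwa [hE] at h

/-- A complex subspace of half the dimension that meets its conjugate trivially is the graph
`{v + i·K v}` of a complex structure `K`. -/
theorem exists_complex_structure_of_inter_conj_eq_zero [FiniteDimensional ℝ V] {n : ℕ}
    (hdim : Module.finrank ℝ V = 2 * n) {E : Submodule ℂ (ℂ ⊗[ℝ] V)}
    (hEdim : Module.finrank ℂ E = n)
    (hE : (E : Set (ℂ ⊗[ℝ] V)) ∩ (complexificationConj V '' (E : Set (ℂ ⊗[ℝ] V))) = {0}) :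
    ∃ K : V →ₗ[ℝ] V, (∀ v : V, K (K v) = -v) ∧
      (E : Set (ℂ ⊗[ℝ] V)) =
        {x | ∃ v : V, x = (1 : ℂ) ⊗ₜ[ℝ] v + Complex.I ⊗ₜ[ℝ] (K v)} := by
  let F : Submodule ℝ (ℂ ⊗[ℝ] V) := E.restrictScalars ℝ
  let re : F →ₗ[ℝ] V := complexificationRe V ∘ₗ F.subtype
  have hinj : Function.Injective re := by
    rw [injective_iff_map_eq_zero]
    intro x hx
    exact Subtype.ext (eq_zero_of_complexificationRe_eq_zero hE x.2 hx)
  have hrank : Module.finrank ℝ F = Module.finrank ℝ V := by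
    rw [hdim, ← hEdim]
    exact finrank_real_of_complex E
  have : FiniteDimensional ℝ F := FiniteDimensional.of_injective re hinj
  let e : F ≃ₗ[ℝ] V := LinearEquiv.ofBijective re
    ⟨hinj, (LinearMap.injective_iff_surjective_of_finrank_eq_finrank hrank).1 hinj⟩
  let K : V →ₗ[ℝ] V := complexificationIm V ∘ₗ F.subtype ∘ₗ e.symm.toLinearMap
  have hK : ∀ x ∈ E, K (complexificationRe V x) = complexificationIm V x := fun x hx ↦
    congrArg (fun y : F ↦ complexificationIm V y) (e.symm_apply_apply ⟨x, hx⟩)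
  have hsurj : ∀ v, ∃ x ∈ E, complexificationRe V x = v := fun v ↦
    ⟨e.symm v, (e.symm v).2, e.apply_symm_apply v⟩
  refine ⟨K, fun v ↦ ?_, Set.ext fun x ↦ ⟨fun hx ↦ ?_, ?_⟩⟩
  · obtain ⟨x, hx, rfl⟩ := hsurj v
    have h := hK _ (E.smul_mem Complex.I hx)
    rw [complexificationRe_I_smul, complexificationIm_I_smul, map_neg] at h
    rw [hK x hx, ← h, neg_neg]
  · exact ⟨complexificationRe V x, by rw [hK x hx, one_tmul_re_add_I_tmul_im]⟩
  · rintro ⟨v, rfl⟩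
    obtain ⟨x, hx, rfl⟩ := hsurj v
    rwa [hK x hx, one_tmul_re_add_I_tmul_im]

/-- A real-linear map is determined by its graph `{v + i·K v}`. -/
theorem eq_of_forall_one_tmul_add_I_tmul_mem {K K' : V →ₗ[ℝ] V}
    (h : ∀ v : V, (1 : ℂ) ⊗ₜ[ℝ] v + Complex.I ⊗ₜ[ℝ] (K v) ∈
      {x : ℂ ⊗[ℝ] V | ∃ w : V, x = (1 : ℂ) ⊗ₜ[ℝ] w + Complex.I ⊗ₜ[ℝ] (K' w)}) :
    K = K' := by
  ext v
  obtain ⟨w, hw⟩ := h v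
  have hre := congrArg (complexificationRe V) hw
  have him := congrArg (complexificationIm V) hw
  simp only [map_add, complexificationRe_tmul, complexificationIm_tmul, Complex.one_re,
    Complex.one_im, Complex.I_re, Complex.I_im, one_smul, zero_smul, add_zero, zero_add] at hre him
  rw [him, hre]

theorem baseChange_one_tmul_add_I_tmul (Ω : LinearMap.BilinForm ℝ V) (v v' w w' : V) :
    (Ω.baseChange ℂ) ((1 : ℂ) ⊗ₜ[ℝ] v + Complex.I ⊗ₜ[ℝ] v')
      ((1 : ℂ) ⊗ₜ[ℝ] w + Complex.I ⊗ₜ[ℝ] w') =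
      ⟨Ω v w - Ω v' w', Ω v w' + Ω v' w⟩ := by
  apply Complex.ext
  · simp [LinearMap.BilinForm.baseChange_tmul]
    ring
  · simp [LinearMap.BilinForm.baseChange_tmul]

end Complexification

/-- Lemma 4.1 / Lemma 5.1 of the paper, after Guillemin–Sternberg.
Let `V` be a real vector space of dimension `2 n` carrying a nondegenerate alternating bilinear
form `Ω`, and let `E` be a complex subspace of the complexification `V_ℂ = ℂ ⊗[ℝ] V` with
`dim_ℂ E = n`, on which the complex-bilinear extension `Ω_ℂ = Ω.baseChange ℂ` vanishes
identically (`E` is Lagrangian), and with `E ∩ Ē = {0}`.  Then: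
* there is a unique `ℝ`-linear `K : V → V` with (i) `K ∘ K = -id` and
  (ii) `E = {v + i·K v : v ∈ V}`;
* moreover any such `K` satisfies (iii) `Ω (K v) (K w) = Ω v w`, and (iv) the bilinear form
  `B (v, w) := Ω (v, K w)` is symmetric and nondegenerate. -/
theorem exists_unique_compatible_complex_structure_of_lagrangian
    {V : Type*} [AddCommGroup V] [Module ℝ V] [FiniteDimensional ℝ V] (n : ℕ)
    (hdim : Module.finrank ℝ V = 2 * n)
    (Ω : LinearMap.BilinForm ℝ V)
    (hΩalt : ∀ v : V, Ω v v = 0)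
    (hΩnd : ∀ v : V, (∀ w : V, Ω v w = 0) → v = 0)
    (E : Submodule ℂ (ℂ ⊗[ℝ] V))
    (hEdim : Module.finrank ℂ E = n)
    (hElag : ∀ x ∈ E, ∀ y ∈ E, (Ω.baseChange ℂ) x y = 0)
    (hEconj : (E : Set (ℂ ⊗[ℝ] V)) ∩ (complexificationConj V '' (E : Set (ℂ ⊗[ℝ] V))) = {0}) :
    (∃! K : V →ₗ[ℝ] V, (∀ v : V, K (K v) = -v) ∧
        (E : Set (ℂ ⊗[ℝ] V)) =
          {x | ∃ v : V, x = (1 : ℂ) ⊗ₜ[ℝ] v + Complex.I ⊗ₜ[ℝ] (K v)}) ∧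
    (∀ K : V →ₗ[ℝ] V,
      ((∀ v : V, K (K v) = -v) ∧
        (E : Set (ℂ ⊗[ℝ] V)) =
          {x | ∃ v : V, x = (1 : ℂ) ⊗ₜ[ℝ] v + Complex.I ⊗ₜ[ℝ] (K v)}) →
      (∀ v w : V, Ω (K v) (K w) = Ω v w) ∧
      (∀ v w : V, Ω v (K w) = Ω w (K v)) ∧
      (∀ v : V, (∀ w : V, Ω v (K w) = 0) → v = 0)) := by
  refine ⟨?_, ?_⟩
  · obtain ⟨K, hK, hEK⟩ := exists_complex_structure_of_inter_conj_eq_zero hdim hEdim hEconj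
    refine ⟨K, ⟨hK, hEK⟩, fun K' ⟨_, hEK'⟩ ↦ eq_of_forall_one_tmul_add_I_tmul_mem fun v ↦ ?_⟩
    rw [← hEK, hEK']
    exact ⟨v, rfl⟩
  · rintro K ⟨hK, hEK⟩
    have hmem : ∀ v, (1 : ℂ) ⊗ₜ[ℝ] v + Complex.I ⊗ₜ[ℝ] (K v) ∈ E := fun v ↦ by
      rw [← SetLike.mem_coe, hEK]
      exact ⟨v, rfl⟩
    have hzero : ∀ v w, Ω v w - Ω (K v) (K w) = 0 ∧ Ω v (K w) + Ω (K v) w = 0 := fun v w ↦ by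
      have h := hElag _ (hmem v) _ (hmem w)
      rw [baseChange_one_tmul_add_I_tmul] at h
      exact Complex.ext_iff.1 h
    refine ⟨fun v w ↦ (sub_eq_zero.1 (hzero v w).1).symm, fun v w ↦ ?_, fun v hv ↦ ?_⟩
    · rw [eq_neg_of_add_eq_zero_left (hzero v w).2]
      exact LinearMap.IsAlt.neg hΩalt (K v) w
    · refine hΩnd v fun w ↦ ?_
      simpa [hK] using hv (K w)
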